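/- Let p ∈ ℂ[z_1,…,z_d] have total degree at most N, written p(z) = Σ_{|α|≤N} p_α z^α. Suppose ‖p(T)‖ ≤ 1 for every simple N-nilpotent d-tuple T of contractive matrices. Then there exist positive semi-definite complex matrices A^1,…,A^d with rows and columns indexed by [N] such that for all α, β ∈ [N]: δ_{0,α,β} − conj(p_α)·p_β = Σ_{j=1}^d (A^j_{α,β} − A^j_{α−e_j, β−e_j}). -/

import Mathlib

open scoped ComplexConjugate ComplexOrder

/-- The operator (spectral) norm of a complex matrix, i.e. the norm of the induced
operator on Euclidean space. -/
noncomputable def matOpNorm {ι : Type*} [Fintype ι] (M : Matrix ι ι ℂ) : ℝ :=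
  letI := Classical.decEq ι
  ‖Matrix.toEuclideanCLM (𝕜 := ℂ) M‖

/-- Evaluation `p(T) = ∑_α p_α T^α` of a polynomial `p ∈ ℂ[z_1,…,z_d]` on a
`d`-tuple of elements of a `ℂ`-algebra, where `T^α = T_1^{α_1} ⋯ T_d^{α_d}`. -/
noncomputable def polyEval {d : ℕ} (p : MvPolynomial (Fin d) ℂ)
    {A : Type*} [Ring A] [Algebra ℂ A] (T : Fin d → A) : A :=
  ∑ α ∈ p.support, p.coeff α • (List.ofFn fun j => T j ^ α j).prod

/-- The `j`-th standard unit multi-index `e_j`. -/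
def eVec {d : ℕ} (j : Fin d) : Fin d → ℕ := fun i => if i = j then 1 else 0

/-- A simple `N`-nilpotent `d`-tuple: pairwise commuting `n × n` matrices together with a
spanning set `{b_α : |α| ≤ N}` of `ℂ^n` such that `T_j b_α = b_{α+e_j}` when `|α| ≤ N-1`
and `T_j b_α = 0` when `|α| = N`. -/
def IsSimpleNilTuple (d N n : ℕ) (T : Fin d → Matrix (Fin n) (Fin n) ℂ) : Prop :=
  (∀ i j, Commute (T i) (T j)) ∧
  ∃ b : (Fin d → ℕ) → (Fin n → ℂ),
    Submodule.span ℂ {v | ∃ α : Fin d → ℕ, (∑ i, α i) ≤ N ∧ v = b α} = ⊤ ∧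
    (∀ (j : Fin d) (α : Fin d → ℕ), (∑ i, α i) < N → (T j).mulVec (b α) = b (α + eVec j)) ∧
    (∀ (j : Fin d) (α : Fin d → ℕ), (∑ i, α i) = N → (T j).mulVec (b α) = 0)

/-- The index set `[N] = {α ∈ ℕ_0^d : |α| ≤ N}`. -/
abbrev MIdx (d N : ℕ) := {α : Fin d → Fin (N + 1) // (∑ j, (α j : ℕ)) ≤ N}

/-- View a multi-index `α ∈ ℕ_0^d` with `|α| ≤ N` as an element of `[N]`. -/
def toIdx {d N : ℕ} (α : Fin d → ℕ) (h : (∑ j, α j) ≤ N) : MIdx d N :=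
  ⟨fun j => ⟨α j, Nat.lt_succ_of_le ((Finset.single_le_sum (f := α)
      (fun i _ => Nat.zero_le _) (Finset.mem_univ j)).trans h)⟩, h⟩

/-- The entry `A_{α,β}` of a matrix indexed by `[N]`, extended by `0` whenever an index
falls outside `[N]`. -/
noncomputable def extMat {d N : ℕ} (A : Matrix (MIdx d N) (MIdx d N) ℂ)
    (α β : Fin d → ℕ) : ℂ :=
  if h : (∑ j, α j) ≤ N ∧ (∑ j, β j) ≤ N then A (toIdx α h.1) (toIdx β h.2) else 0

/-- `∑_{j=1}^d (A^j_{α,β} − A^j_{α−e_j,β−e_j})`, with out-of-bounds entries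
(in particular when `α_j = 0` or `β_j = 0`) taken to be `0`. -/
noncomputable def coneEntry {d N : ℕ} (A : Fin d → Matrix (MIdx d N) (MIdx d N) ℂ)
    (α β : Fin d → ℕ) : ℂ :=
  ∑ j, (extMat (A j) α β -
    if α j = 0 ∨ β j = 0 then 0 else extMat (A j) (α - eVec j) (β - eVec j))


namespace SNil
open Matrix

def vl {d N : ℕ} (γ : MIdx d N) : Fin d → ℕ := fun j => (γ.1 j : ℕ)

lemma vl_le {d N : ℕ} (γ : MIdx d N) : (∑ i, vl γ i) ≤ N := γ.2

lemma vl_inj {d N : ℕ} {γ δ : MIdx d N} (h : vl γ = vl δ) : γ = δ := by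
  apply Subtype.ext
  funext j
  apply Fin.ext
  exact congrFun h j

lemma vl_toIdx {d N : ℕ} (α : Fin d → ℕ) (h : (∑ j, α j) ≤ N) : vl (toIdx α h) = α := rfl

lemma toIdx_vl {d N : ℕ} (γ : MIdx d N) (h : (∑ j, vl γ j) ≤ N) : toIdx (vl γ) h = γ := rfl

lemma sum_eVec {d : ℕ} (j : Fin d) : (∑ i, eVec j i) = 1 := by simp [eVec]

lemma sum_add_eVec {d : ℕ} (α : Fin d → ℕ) (j : Fin d) :
    (∑ i, (α + eVec j) i) = (∑ i, α i) + 1 := by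
  simp only [Pi.add_apply, Finset.sum_add_distrib, sum_eVec]

noncomputable def EE (d N : ℕ) (α : Fin d → ℕ) : MIdx d N → ℂ := fun γ => if vl γ = α then 1 else 0

noncomputable def SS (d N : ℕ) (j : Fin d) : Matrix (MIdx d N) (MIdx d N) ℂ :=
  fun γ δ => if vl γ = vl δ + eVec j then 1 else 0

lemma EE_of_gt {d N : ℕ} (α : Fin d → ℕ) (h : N < ∑ i, α i) : EE d N α = 0 := by
  funext γ
  simp only [EE, Pi.zero_apply, ite_eq_right_iff]
  intro h'
  have := vl_le γ
  rw [h'] at this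
  omega

lemma EE_vl {d N : ℕ} (γ : MIdx d N) : EE d N (vl γ) = Pi.single γ 1 := by
  funext δ
  by_cases h : δ = γ
  · subst h; simp [EE]
  · have : vl δ ≠ vl γ := fun h' => h (vl_inj h')
    simp [EE, this, h]

lemma SS_EE {d N : ℕ} (j : Fin d) (α : Fin d → ℕ) : SS d N j *ᵥ EE d N α = EE d N (α + eVec j) := by
  by_cases h : (∑ i, α i) ≤ N
  · rw [← vl_toIdx α h, EE_vl, mulVec_single_one]
    funext γ
    simp [SS, EE, vl_toIdx, Matrix.col]
  · rw [EE_of_gt α (by omega), EE_of_gt _ (by rw [sum_add_eVec]; omega), mulVec_zero]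

lemma mat_ext {d N : ℕ} {n : Type*} {A B : Matrix n (MIdx d N) ℂ}
    (h : ∀ α, A *ᵥ EE d N α = B *ᵥ EE d N α) : A = B := by
  ext i γ
  have := congrFun (h (vl γ)) i
  rw [EE_vl, mulVec_single_one, mulVec_single_one] at this
  exact this

lemma SS_comm {d N : ℕ} (i j : Fin d) : SS d N i * SS d N j = SS d N j * SS d N i := by
  apply mat_ext
  intro α
  rw [← mulVec_mulVec, ← mulVec_mulVec, SS_EE, SS_EE, SS_EE, SS_EE, add_right_comm]

lemma pow_mulVec {d : ℕ} {n : Type*} [Fintype n] [DecidableEq n] (T : Fin d → Matrix n n ℂ)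
    (b : (Fin d → ℕ) → n → ℂ) (hb : ∀ j α, T j *ᵥ b α = b (α + eVec j)) (j : Fin d) (m : ℕ)
    (α : Fin d → ℕ) : (T j ^ m) *ᵥ b α = b (α + m • eVec j) := by
  induction m generalizing α with
  | zero => simp
  | succ m ih =>
    rw [pow_succ, ← mulVec_mulVec, hb, ih]
    congr 1
    rw [succ_nsmul, add_assoc, add_comm (eVec j)]

lemma list_mulVec {d : ℕ} {n : Type*} [Fintype n] [DecidableEq n] (T : Fin d → Matrix n n ℂ)
    (b : (Fin d → ℕ) → n → ℂ) (hb : ∀ j α, T j *ᵥ b α = b (α + eVec j)) (m : Fin d → ℕ)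
    (l : List (Fin d)) (α : Fin d → ℕ) :
    ((l.map fun j => T j ^ m j).prod) *ᵥ b α = b (α + (l.map fun j => m j • eVec j).sum) := by
  induction l generalizing α with
  | nil => simp
  | cons j l ih =>
    rw [List.map_cons, List.prod_cons, ← mulVec_mulVec, ih, pow_mulVec T b hb, List.map_cons,
      List.sum_cons]
    congr 1
    rw [add_assoc, add_comm (m j • eVec j)]

lemma mono_mulVec {d : ℕ} {n : Type*} [Fintype n] [DecidableEq n] (T : Fin d → Matrix n n ℂ)
    (b : (Fin d → ℕ) → n → ℂ) (hb : ∀ j α, T j *ᵥ b α = b (α + eVec j)) (m : Fin d → ℕ) :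
    (List.ofFn fun j => T j ^ m j).prod *ᵥ b 0 = b m := by
  rw [List.ofFn_eq_map, list_mulVec T b hb, ← List.ofFn_eq_map, List.sum_ofFn, zero_add]
  congr 1
  funext i
  simp [eVec, Finset.sum_apply]

lemma SS_nil {d N : ℕ} (j : Fin d) : SS d N j ^ (N + 1) = 0 := by
  apply mat_ext
  intro α
  rw [pow_mulVec (SS d N) (EE d N) SS_EE, zero_mulVec, EE_of_gt]
  simp only [Pi.add_apply, Finset.sum_add_distrib, Pi.smul_apply, ← Finset.smul_sum, sum_eVec]
  simp
  omega

noncomputable def pv {d : ℕ} (N : ℕ) (p : MvPolynomial (Fin d) ℂ) : MIdx d N → ℂ :=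
  fun γ => p.coeff (Finsupp.equivFunOnFinite.symm (vl γ))

lemma pv_eq {d N : ℕ} (p : MvPolynomial (Fin d) ℂ) (hdeg : p.totalDegree ≤ N) :
    ∑ α ∈ p.support, p.coeff α • EE d N α = pv N p := by
  funext γ
  rw [Finset.sum_apply]
  simp only [Pi.smul_apply, EE, smul_eq_mul, mul_ite, mul_one, mul_zero, pv]
  have : ∀ α : Fin d →₀ ℕ, (vl γ = ⇑α) ↔ (Finsupp.equivFunOnFinite.symm (vl γ) = α) := by
    intro α
    constructor
    · intro h; ext i; simp [h]
    · intro h; rw [← h]; rfl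
  simp only [this]
  rw [Finset.sum_ite_eq]
  split_ifs with h
  · rfl
  · exact (MvPolynomial.notMem_support_iff.mp h).symm

def nsq {n : Type*} [Fintype n] (v : n → ℂ) : ℝ := (star v ⬝ᵥ v).re

lemma nsq_eq {n : Type*} [Fintype n] (v : n → ℂ) : nsq v = ‖WithLp.toLp 2 v‖ ^ 2 := by
  rw [EuclideanSpace.norm_sq_eq, nsq, dotProduct, Complex.re_sum]
  apply Finset.sum_congr rfl
  intro i _
  simp only [Pi.star_apply, RCLike.star_def]
  rw [← Complex.normSq_eq_conj_mul_self, Complex.ofReal_re, Complex.normSq_eq_norm_sq]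

lemma matOpNorm_le {n : Type*} [Fintype n] (M : Matrix n n ℂ) :
    matOpNorm M ≤ 1 ↔ ∀ v, nsq (M *ᵥ v) ≤ nsq v := by
  classical
  unfold matOpNorm
  rw [ContinuousLinearMap.opNorm_le_iff zero_le_one]
  constructor
  · intro h v
    have := h (WithLp.toLp 2 v)
    rw [toEuclideanCLM_toLp, one_mul] at this
    rw [nsq_eq, nsq_eq]
    gcongr
  · intro h v
    have := h (WithLp.ofLp v)
    rw [nsq_eq, nsq_eq] at this
    rw [one_mul]
    exact le_of_sq_le_sq this (norm_nonneg _)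

lemma core {d N : ℕ} (p : MvPolynomial (Fin d) ℂ)
    (hdeg : p.totalDegree ≤ N)
    (hvN : ∀ (n : ℕ) (T : Fin d → Matrix (Fin n) (Fin n) ℂ),
        IsSimpleNilTuple d N n T → (∀ j, matOpNorm (T j) ≤ 1) →
        matOpNorm (polyEval p T) ≤ 1)
    {n : ℕ} (R : Matrix (Fin n) (MIdx d N) ℂ) (Q : Matrix (MIdx d N) (Fin n) ℂ)
    (hRQ : R * Q = 1) (hQR : Q * R = 1)
    (hc : ∀ j v, nsq (R *ᵥ (SS d N j *ᵥ v)) ≤ nsq (R *ᵥ v)) :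
    nsq (R *ᵥ pv N p) ≤ nsq (R *ᵥ EE d N 0) := by
  set T : Fin d → Matrix (Fin n) (Fin n) ℂ := fun j => R * SS d N j * Q with hT
  set b : (Fin d → ℕ) → Fin n → ℂ := fun α => R *ᵥ EE d N α with hbdef
  have hTR : ∀ j v, T j *ᵥ (R *ᵥ v) = R *ᵥ (SS d N j *ᵥ v) := by
    intro j v
    rw [hT, mulVec_mulVec, Matrix.mul_assoc, hQR, Matrix.mul_one, mulVec_mulVec]
  have hb : ∀ j α, T j *ᵥ b α = b (α + eVec j) := by
    intro j α
    simp only [hbdef]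
    rw [hTR, SS_EE]
  have hcomm : ∀ i j, Commute (T i) (T j) := by
    intro i j
    have : ∀ i j, T i * T j = R * (SS d N i * SS d N j) * Q := by
      intro i j
      calc T i * T j = R * SS d N i * (Q * R) * SS d N j * Q := by
            simp only [hT, Matrix.mul_assoc]
        _ = _ := by rw [hQR]; simp only [Matrix.mul_assoc, Matrix.mul_one]
    rw [commute_iff_eq, this, this, SS_comm]
  have hsurj : ∀ x, R *ᵥ (Q *ᵥ x) = x := by
    intro x
    rw [mulVec_mulVec, hRQ, one_mulVec]
  have hsimple : IsSimpleNilTuple d N n T := by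
    refine ⟨hcomm, b, ?_, fun j α _ => hb j α, ?_⟩
    · rw [eq_top_iff]
      intro x _
      have hx : x = ∑ γ, (Q *ᵥ x) γ • b (vl γ) := by
        conv_lhs => rw [← hsurj x]
        have h1 : (Q *ᵥ x) = ∑ γ, (Q *ᵥ x) γ • EE d N (vl γ) := by
          simp only [EE_vl]
          exact pi_eq_sum_univ' _
        conv_lhs => rw [h1]
        rw [mulVec_sum]
        simp only [mulVec_smul, hbdef]
      rw [hx]
      apply Submodule.sum_mem
      intro γ _
      apply Submodule.smul_mem
      exact Submodule.subset_span ⟨vl γ, vl_le γ, rfl⟩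
    · intro j α h
      have := hb j α
      rw [this]
      simp only [hbdef]
      rw [EE_of_gt _ (by rw [sum_add_eVec]; omega), mulVec_zero]
  have hcontr : ∀ j, matOpNorm (T j) ≤ 1 := by
    intro j
    rw [matOpNorm_le]
    intro x
    rw [← hsurj x, hTR]
    exact hc _ _
  have key := (matOpNorm_le _).1 (hvN n T hsimple hcontr) (b 0)
  have : polyEval p T *ᵥ b 0 = R *ᵥ pv N p := by
    rw [← pv_eq p hdeg, polyEval, sum_mulVec, mulVec_sum]
    apply Finset.sum_congr rfl
    intro α _
    rw [smul_mulVec, mono_mulVec T b hb, mulVec_smul]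
  rw [this] at key
  exact key

noncomputable def kf {n : Type*} [Fintype n] (K : Matrix n n ℂ) (v : n → ℂ) : ℝ :=
  (star v ⬝ᵥ (K *ᵥ v)).re

lemma kf_RR {n m : Type*} [Fintype n] [Fintype m] (R : Matrix m n ℂ) (v : n → ℂ) :
    nsq (R *ᵥ v) = kf (Rᴴ * R) v := by
  rw [nsq, kf, star_mulVec, ← mulVec_mulVec, dotProduct_mulVec (star v)]

open scoped MatrixOrder Matrix.Norms.L2Operator in
lemma sqrt_ex {n : Type*} [Fintype n] [DecidableEq n] (G : Matrix n n ℂ) (hG : G.PosDef) :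
    ∃ B : Matrix n n ℂ, G = Bᴴ * B ∧ IsUnit B := by
  obtain ⟨B, hB⟩ := CStarAlgebra.nonneg_iff_eq_star_mul_self.1 hG.posSemidef.nonneg
  refine ⟨B, hB, ?_⟩
  have := hG.isUnit
  rw [hB, isUnit_iff_isUnit_det, det_mul] at this
  exact (isUnit_iff_isUnit_det B).2 (isUnit_of_mul_isUnit_right this)

lemma core2 {d N : ℕ} (p : MvPolynomial (Fin d) ℂ)
    (hdeg : p.totalDegree ≤ N)
    (hvN : ∀ (n : ℕ) (T : Fin d → Matrix (Fin n) (Fin n) ℂ),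
        IsSimpleNilTuple d N n T → (∀ j, matOpNorm (T j) ≤ 1) →
        matOpNorm (polyEval p T) ≤ 1)
    (G : Matrix (MIdx d N) (MIdx d N) ℂ) (hG : G.PosDef)
    (hc : ∀ j v, kf G (SS d N j *ᵥ v) ≤ kf G v) :
    kf G (pv N p) ≤ kf G (EE d N 0) := by
  obtain ⟨B, rfl, hB⟩ := sqrt_ex G hG
  have hdet := (isUnit_iff_isUnit_det B).1 hB
  let e := Fintype.equivFin (MIdx d N)
  let R : Matrix (Fin (Fintype.card (MIdx d N))) (MIdx d N) ℂ := B.submatrix e.symm id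
  let Q : Matrix (MIdx d N) (Fin (Fintype.card (MIdx d N))) ℂ := B⁻¹.submatrix id e.symm
  have hRR : Rᴴ * R = Bᴴ * B := by
    simp only [R, conjTranspose_submatrix]
    rw [submatrix_mul_equiv]; simp
  have := core p hdeg hvN R Q ?_ ?_ ?_
  · simpa only [kf_RR, hRR] using this
  · simp only [R, Q]
    rw [← submatrix_mul _ _ _ _ _ Function.bijective_id, mul_nonsing_inv _ hdet, submatrix_one_equiv]
  · simp only [R, Q]
    rw [submatrix_mul_equiv, nonsing_inv_mul _ hdet]; simp
  · intro j v
    simp only [kf_RR, hRR]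
    exact hc j v

lemma kf_add {n : Type*} [Fintype n] (K L : Matrix n n ℂ) (v : n → ℂ) :
    kf (K + L) v = kf K v + kf L v := by
  simp [kf, add_mulVec]

lemma kf_smul {n : Type*} [Fintype n] (c : ℝ) (K : Matrix n n ℂ) (v : n → ℂ) :
    kf ((c : ℂ) • K) v = c * kf K v := by
  simp [kf, smul_mulVec]

lemma kf_one {n : Type*} [Fintype n] [DecidableEq n] (v : n → ℂ) :
    kf (1 : Matrix n n ℂ) v = nsq v := by
  simp [kf, nsq]

lemma kf_conj {n : Type*} [Fintype n] (K : Matrix n n ℂ) (v : n → ℂ) :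
    kf Kᴴ v = kf K v := by
  have : star v ⬝ᵥ (Kᴴ *ᵥ v) = star (star v ⬝ᵥ (K *ᵥ v)) := by
    rw [star_dotProduct, star_mulVec, ← dotProduct_mulVec, conjTranspose_conjTranspose]
  rw [kf, this, kf]; simp

lemma SDS {d N : ℕ} (j : Fin d) (w : (Fin d → ℕ) → ℂ) (hw : ∀ α, N < ∑ i, α i → w α = 0) :
    (SS d N j)ᴴ * (diagonal (fun γ : MIdx d N => w (vl γ)) * SS d N j) =
      diagonal (fun γ => w (vl γ + eVec j)) := by
  ext β γ
  rw [mul_apply]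
  simp only [diagonal_mul, conjTranspose_apply, SS]
  by_cases h : β = γ
  · subst h
    rw [diagonal_apply_eq]
    by_cases hN : (∑ i, (vl β + eVec j) i) ≤ N
    · rw [Finset.sum_eq_single (toIdx _ hN)]
      · simp [vl_toIdx]
      · intro δ _ hδ
        have : vl δ ≠ vl β + eVec j := fun h => hδ (vl_inj (h.trans (vl_toIdx _ hN).symm))
        simp [this]
      · simp
    · rw [hw _ (by omega)]
      apply Finset.sum_eq_zero
      intro δ _
      have : vl δ ≠ vl β + eVec j := by
        intro h
        apply hN
        rw [← h]
        exact vl_le δ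
      simp [this]
  · rw [diagonal_apply_ne _ h]
    apply Finset.sum_eq_zero
    intro δ _
    by_cases h1 : vl δ = vl β + eVec j
    · have h2 : vl δ ≠ vl γ + eVec j := by
        intro h2
        apply h
        apply vl_inj
        exact add_right_cancel (h1.symm.trans h2)
      simp [h2]
    · simp [h1]

lemma nsq_SS {d N : ℕ} (j : Fin d) (v : MIdx d N → ℂ) : nsq (SS d N j *ᵥ v) ≤ nsq v := by
  have h := SDS (N := N) j (fun α => if (∑ i, α i) ≤ N then 1 else 0)
    (fun α h => if_neg (by omega))
  have h1 : diagonal (fun γ : MIdx d N => if (∑ i, vl γ i) ≤ N then (1 : ℂ) else 0) = 1 := by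
    simp [vl_le]
  rw [h1, Matrix.one_mul] at h
  rw [kf_RR, h, kf, nsq, dotProduct, dotProduct, Complex.re_sum, Complex.re_sum]
  apply Finset.sum_le_sum
  intro γ _
  rw [mulVec_diagonal]
  have h0 : 0 ≤ (star v γ * v γ).re := by
    rw [Pi.star_apply, RCLike.star_def, ← Complex.normSq_eq_conj_mul_self, Complex.ofReal_re]
    exact Complex.normSq_nonneg _
  split_ifs
  · simp
  · simpa using h0

lemma core3 {d N : ℕ} (hd : 1 ≤ d) (p : MvPolynomial (Fin d) ℂ)
    (hdeg : p.totalDegree ≤ N)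
    (hvN : ∀ (n : ℕ) (T : Fin d → Matrix (Fin n) (Fin n) ℂ),
        IsSimpleNilTuple d N n T → (∀ j, matOpNorm (T j) ≤ 1) →
        matOpNorm (polyEval p T) ≤ 1)
    (K : Matrix (MIdx d N) (MIdx d N) ℂ)
    (hc : ∀ j v, kf K (SS d N j *ᵥ v) ≤ kf K v) :
    kf K (pv N p) ≤ kf K (EE d N 0) := by
  have hpos : ∀ v, 0 ≤ kf K v := by
    intro v
    have h : ∀ m, kf K ((SS d N ⟨0, hd⟩ ^ m) *ᵥ v) ≤ kf K v := by
      intro m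
      induction m with
      | zero => simp
      | succ m ih =>
        rw [pow_succ', ← mulVec_mulVec]
        exact (hc _ _).trans ih
    have := h (N + 1)
    rw [SS_nil] at this
    simpa [kf] using this
  have hε : ∀ ε : ℝ, 0 < ε → kf K (pv N p) + ε * nsq (pv N p) ≤
      kf K (EE d N 0) + ε * nsq (EE d N 0) := by
    intro ε hε
    set G : Matrix (MIdx d N) (MIdx d N) ℂ :=
      ((1 / 2 : ℝ) : ℂ) • (K + Kᴴ) + (ε : ℂ) • (1 : Matrix (MIdx d N) (MIdx d N) ℂ) with hGdef
    have hk : ∀ v, kf G v = kf K v + ε * nsq v := by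
      intro v
      rw [hGdef, kf_add, kf_smul, kf_smul, kf_add, kf_conj, kf_one]
      ring
    have hH : G.IsHermitian := by
      rw [hGdef, IsHermitian]
      simp [add_comm]
    have hGp : G.PosDef := by
      apply PosDef.of_dotProduct_mulVec_pos hH
      intro x hx
      rw [Complex.pos_iff]
      constructor
      · have := hk x
        rw [kf] at this
        rw [this]
        have h1 : 0 < nsq x := by
          rw [nsq_eq]
          have : 0 < ‖WithLp.toLp 2 x‖ := by
            rw [norm_pos_iff]
            intro h
            apply hx
            simpa using h
          positivity
        have := hpos x
        positivity
      · exact (hH.im_star_dotProduct_mulVec_self x).symm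
    have := core2 p hdeg hvN G hGp ?_
    · simpa only [hk] using this
    · intro j v
      rw [hk, hk]
      have := nsq_SS j v
      have := hc j v
      gcongr
  by_contra hcon
  push Not at hcon
  set a := kf K (pv N p) - kf K (EE d N 0) with ha
  have ha0 : 0 < a := by rw [ha]; linarith
  have hE : 0 ≤ nsq (EE d N 0) := by rw [nsq_eq]; positivity
  have hP : 0 ≤ nsq (pv N p) := by rw [nsq_eq]; positivity
  have h2 := hε (a / (2 * (nsq (EE d N 0) + 1))) (by positivity)
  have h3 : a / (2 * (nsq (EE d N 0) + 1)) * nsq (EE d N 0) ≤ a / 2 := by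
    rw [div_mul_eq_mul_div, div_le_div_iff₀ (by positivity) (by positivity)]
    nlinarith
  have h4 : 0 ≤ a / (2 * (nsq (EE d N 0) + 1)) * nsq (pv N p) := by positivity
  linarith

end SNil

namespace SNil
open Matrix

lemma sub_eVec_add {d : ℕ} (α : Fin d → ℕ) (j : Fin d) (h : α j ≠ 0) : α - eVec j + eVec j = α := by
  funext i
  by_cases hi : i = j
  · subst hi
    simp [eVec]; omega
  · simp [eVec, hi]

lemma sum_sub_le {d N : ℕ} (α : Fin d → ℕ) (hα : (∑ i, α i) ≤ N) (j : Fin d) :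
    (∑ i, (α - eVec j) i) ≤ N :=
  (Finset.sum_le_sum fun i _ => Nat.sub_le _ _).trans hα

lemma SS_row {d N : ℕ} (j : Fin d) (α : Fin d → ℕ) (hα : (∑ i, α i) ≤ N) (u : MIdx d N → ℂ) :
    ∑ γ, SS d N j (toIdx α hα) γ * u γ =
      if α j = 0 then 0 else u (toIdx (α - eVec j) (sum_sub_le α hα j)) := by
  split_ifs with h
  · apply Finset.sum_eq_zero
    intro γ _
    have : α ≠ vl γ + eVec j := by
      intro h'
      have := congrFun h' j
      simp [eVec, h] at this
    simp [SS, vl_toIdx, this]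
  · rw [Finset.sum_eq_single (toIdx (α - eVec j) (sum_sub_le α hα j))]
    · simp [SS, vl_toIdx, sub_eVec_add α j h]
    · intro γ _ hγ
      have : α ≠ vl γ + eVec j := by
        intro h'
        apply hγ
        apply vl_inj
        rw [vl_toIdx, h']
        simp
      simp [SS, vl_toIdx, this]
    · simp

lemma star_SS {d N : ℕ} (j : Fin d) (γ δ : MIdx d N) : star (SS d N j γ δ) = SS d N j γ δ := by
  simp only [SS]
  split_ifs <;> simp

lemma SS_conj_entry {d N : ℕ} (A : Matrix (MIdx d N) (MIdx d N) ℂ) (j : Fin d) (α β : Fin d → ℕ)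
    (hα : (∑ i, α i) ≤ N) (hβ : (∑ i, β i) ≤ N) :
    (SS d N j * A * (SS d N j)ᴴ) (toIdx α hα) (toIdx β hβ) =
      if α j = 0 ∨ β j = 0 then 0 else extMat A (α - eVec j) (β - eVec j) := by
  rw [mul_apply]
  simp only [conjTranspose_apply, star_SS]
  simp only [mul_comm _ (SS d N j (toIdx β hβ) _)]
  rw [SS_row]
  simp only [mul_apply]
  rw [SS_row]
  have h : (∑ i, (α - eVec j) i) ≤ N ∧ (∑ i, (β - eVec j) i) ≤ N :=
    ⟨sum_sub_le α hα j, sum_sub_le β hβ j⟩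
  simp only [extMat, dif_pos h]
  by_cases h1 : α j = 0 <;> by_cases h2 : β j = 0 <;> simp [h1, h2]

noncomputable def Phi {d N : ℕ} :
    (Fin d → Matrix (MIdx d N) (MIdx d N) ℂ) →ₗ[ℝ] Matrix (MIdx d N) (MIdx d N) ℂ where
  toFun A := ∑ j, (A j - SS d N j * A j * (SS d N j)ᴴ)
  map_add' A B := by
    rw [← Finset.sum_add_distrib]
    apply Finset.sum_congr rfl
    intro j _
    rw [Pi.add_apply, Matrix.mul_add, Matrix.add_mul]
    abel
  map_smul' c A := by
    rw [Finset.smul_sum]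
    apply Finset.sum_congr rfl
    intro j _
    simp [smul_sub]

lemma Phi_apply {d N : ℕ} (A : Fin d → Matrix (MIdx d N) (MIdx d N) ℂ) :
    Phi A = ∑ j, (A j - SS d N j * A j * (SS d N j)ᴴ) := rfl

lemma coneEntry_eq {d N : ℕ} (A : Fin d → Matrix (MIdx d N) (MIdx d N) ℂ) (α β : Fin d → ℕ)
    (hα : (∑ i, α i) ≤ N) (hβ : (∑ i, β i) ≤ N) :
    coneEntry A α β = Phi A (toIdx α hα) (toIdx β hβ) := by
  rw [Phi_apply, Matrix.sum_apply, coneEntry]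
  apply Finset.sum_congr rfl
  intro j _
  rw [Matrix.sub_apply, SS_conj_entry]
  congr 1
  rw [extMat, dif_pos ⟨hα, hβ⟩]

noncomputable def wt {d : ℕ} (N : ℕ) (α : Fin d → ℕ) : ℂ := ((N + 1 - (∑ i, α i) : ℕ) : ℂ)

noncomputable def WW (d N : ℕ) : Matrix (MIdx d N) (MIdx d N) ℂ := diagonal (fun γ => wt N (vl γ))

lemma trace_Phi {d N : ℕ} (A : Fin d → Matrix (MIdx d N) (MIdx d N) ℂ) :
    (WW d N * Phi A).trace = ∑ j, (A j).trace := by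
  rw [Phi_apply, Matrix.mul_sum, trace_sum]
  apply Finset.sum_congr rfl
  intro j _
  have h1 : (SS d N j)ᴴ * (WW d N * SS d N j) = WW d N - 1 := by
    rw [WW, SDS j (wt N)]
    · rw [← diagonal_one, diagonal_sub]
      congr 1
      funext γ
      have := vl_le γ
      simp only [wt, sum_add_eVec]
      rw [eq_sub_iff_add_eq]
      norm_cast
      omega
    · intro α h
      simp only [wt]
      norm_cast
      omega
  have h2 : (WW d N * (SS d N j * A j * (SS d N j)ᴴ)).trace =
      ((SS d N j)ᴴ * (WW d N * SS d N j) * A j).trace := by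
    rw [← Matrix.mul_assoc, Matrix.trace_mul_comm]
    simp only [Matrix.mul_assoc]
  rw [Matrix.mul_sub, trace_sub, h2, h1, Matrix.sub_mul, trace_sub, Matrix.one_mul]
  ring

lemma psd_entry_le {n : Type*} [Fintype n] {A : Matrix n n ℂ} (hA : A.PosSemidef) (i j : n) :
    ‖A i j‖ ≤ 2 * A.trace.re := by
  classical
  have hd : ∀ i, 0 ≤ (A i i).re := fun i => (Complex.nonneg_iff.1 (hA.diag_nonneg (i := i))).1
  have htr : ∀ i, (A i i).re ≤ A.trace.re := by
    intro i
    rw [trace, Complex.re_sum]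
    exact Finset.single_le_sum (f := fun i => (A i i).re) (fun i _ => hd i) (Finset.mem_univ i)
  have hq : ∀ z : ℂ, 0 ≤ (A i i + z * A i j + conj z * A j i + conj z * z * A j j).re := by
    intro z
    have := hA.re_dotProduct_nonneg (Pi.single i 1 + z • Pi.single j 1)
    convert this using 2
    simp [mulVec_add, mulVec_smul, add_dotProduct, dotProduct_add]
    ring
  have hH : A j i = conj (A i j) := (hA.1.apply j i).symm
  have hi := htr i
  have hj := htr j
  have h1 := hq 1
  have h2 := hq (-1)
  have h3 := hq Complex.I
  have h4 := hq (-Complex.I)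
  rw [hH] at h1 h2 h3 h4
  simp at h1 h2 h3 h4
  have hre : |(A i j).re| ≤ A.trace.re := abs_le.2 ⟨by linarith, by linarith⟩
  have him : |(A i j).im| ≤ A.trace.re := abs_le.2 ⟨by linarith, by linarith⟩
  have := Complex.norm_le_abs_re_add_abs_im (A i j)
  linarith

def PP (d N : ℕ) : Set (Fin d → Matrix (MIdx d N) (MIdx d N) ℂ) := {A | ∀ j, (A j).PosSemidef}

attribute [local instance] Matrix.normedAddCommGroup Matrix.normedSpace

lemma isClosed_psd {n : Type*} [Fintype n] : IsClosed {A : Matrix n n ℂ | A.PosSemidef} := by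
  have : {A : Matrix n n ℂ | A.PosSemidef} =
      {A | Aᴴ = A} ∩ ⋂ x : n → ℂ, {A | 0 ≤ star x ⬝ᵥ (A *ᵥ x)} := by
    ext A
    simp [posSemidef_iff_dotProduct_mulVec, IsHermitian]
  rw [this]
  apply IsClosed.inter
  · exact isClosed_eq (by fun_prop) (by fun_prop)
  · apply isClosed_iInter
    intro x
    exact isClosed_le continuous_const (by fun_prop)

lemma isClosed_PP (d N : ℕ) : IsClosed (PP d N) := by
  have : PP d N = ⋂ j, (fun A => A j) ⁻¹' {A | A.PosSemidef} := by
    ext A; simp [PP]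
  rw [this]
  exact isClosed_iInter fun j => isClosed_psd.preimage (continuous_apply j)

lemma compact_PP (d N : ℕ) (c : ℝ) :
    IsCompact (PP d N ∩ {A | (∑ j, (A j).trace).re ≤ c}) := by
  have : ProperSpace (Fin d → Matrix (MIdx d N) (MIdx d N) ℂ) := FiniteDimensional.proper ℝ _
  apply Metric.isCompact_of_isClosed_isBounded
  · exact (isClosed_PP d N).inter (isClosed_le (by fun_prop) continuous_const)
  · rw [isBounded_iff_forall_norm_le]
    refine ⟨2 * c, ?_⟩
    rintro A ⟨hA, hc⟩
    have htr : ∀ j, 0 ≤ (A j).trace.re := fun j => (Complex.nonneg_iff.1 (hA j).trace_nonneg).1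
    simp only [Set.mem_ofPred_eq, Complex.re_sum] at hc
    have hc0 : 0 ≤ c := (Finset.sum_nonneg fun j _ => htr j).trans hc
    rw [pi_norm_le_iff_of_nonneg (by positivity)]
    intro j
    rw [Matrix.norm_le_iff (by positivity)]
    intro α β
    have h1 := psd_entry_le (hA j) α β
    have h2 := Finset.single_le_sum (f := fun j => (A j).trace.re) (fun j _ => htr j)
      (Finset.mem_univ j)
    exact h1.trans (by linarith)

lemma isClosed_cone (d N : ℕ) : IsClosed (Phi '' PP d N) := by
  have hPhi : Continuous (Phi : (Fin d → Matrix (MIdx d N) (MIdx d N) ℂ) →ₗ[ℝ] _) :=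
    LinearMap.continuous_of_finiteDimensional _
  apply isClosed_of_closure_subset
  intro x hx
  set c : ℝ := (WW d N * x).trace.re + 1 with hc
  let U : Set (Matrix (MIdx d N) (MIdx d N) ℂ) := {y | (WW d N * y).trace.re < c}
  have hU : IsOpen U := isOpen_lt (by fun_prop) continuous_const
  have hxU : x ∈ U := by
    change (WW d N * x).trace.re < c
    rw [hc]; linarith
  have h1 : x ∈ closure (U ∩ Phi '' PP d N) := hU.inter_closure ⟨hxU, hx⟩
  have h2 : U ∩ Phi '' PP d N ⊆ Phi '' (PP d N ∩ {A | (∑ j, (A j).trace).re ≤ c}) := by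
    rintro _ ⟨hyU, A, hA, rfl⟩
    refine ⟨A, ⟨hA, ?_⟩, rfl⟩
    have : (WW d N * Phi A).trace.re < c := hyU
    rw [trace_Phi] at this
    exact this.le
  have h3 := closure_minimal h2 ((compact_PP d N c).image hPhi).isClosed h1
  exact Set.image_mono Set.inter_subset_left h3

lemma smul_PP {d N : ℕ} {A : Fin d → Matrix (MIdx d N) (MIdx d N) ℂ} (hA : A ∈ PP d N) {t : ℝ}
    (ht : 0 ≤ t) : t • A ∈ PP d N := fun j => (hA j).smul ht

lemma convex_PP (d N : ℕ) : Convex ℝ (PP d N) := by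
  intro A hA B hB s t hs ht _ j
  exact (smul_PP hA hs j).add (smul_PP hB ht j)

lemma functional {n : Type*} [Fintype n] [DecidableEq n] (f : Matrix n n ℂ →ₗ[ℂ] ℂ) (v : n → ℂ) :
    f (vecMulVec (star v) v) = star v ⬝ᵥ ((Matrix.of fun i j => f (Matrix.single i j 1)) *ᵥ v) := by
  conv_lhs => rw [matrix_eq_sum_single (vecMulVec (star v) v)]
  rw [map_sum, dotProduct]
  apply Finset.sum_congr rfl
  intro i _
  rw [map_sum, mulVec, dotProduct, Finset.mul_sum]
  apply Finset.sum_congr rfl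
  intro j _
  have : Matrix.single i j (vecMulVec (star v) v i j) =
      (vecMulVec (star v) v i j) • Matrix.single i j (1 : ℂ) := by
    rw [smul_single]; simp
  rw [this, map_smul, vecMulVec_apply]
  simp
  ring

lemma SS_vecMulVec {d N : ℕ} (j : Fin d) (v : MIdx d N → ℂ) :
    SS d N j * vecMulVec (star v) v * (SS d N j)ᴴ =
      vecMulVec (star (SS d N j *ᵥ v)) (SS d N j *ᵥ v) := by
  rw [mul_vecMulVec, vecMulVec_mul]
  congr 1
  · funext γ
    simp only [mulVec, dotProduct, Pi.star_apply, star_sum, star_mul', star_SS]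
  · funext γ
    simp only [vecMul, mulVec, dotProduct, conjTranspose_apply, star_SS, mul_comm]

lemma exists_cone {d N : ℕ} (hd : 1 ≤ d) (p : MvPolynomial (Fin d) ℂ)
    (hdeg : p.totalDegree ≤ N)
    (hvN : ∀ (n : ℕ) (T : Fin d → Matrix (Fin n) (Fin n) ℂ),
        IsSimpleNilTuple d N n T → (∀ j, matOpNorm (T j) ≤ 1) →
        matOpNorm (polyEval p T) ≤ 1) :
    vecMulVec (star (EE d N 0)) (EE d N 0) - vecMulVec (star (pv N p)) (pv N p) ∈
      Phi '' PP d N := by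
  by_contra hM
  have hlc : LocallyConvexSpace ℝ (Matrix (MIdx d N) (MIdx d N) ℂ) :=
    inferInstanceAs (LocallyConvexSpace ℝ (MIdx d N → MIdx d N → ℂ))
  obtain ⟨f, u, hu, hf⟩ := RCLike.geometric_hahn_banach_point_closed (𝕜 := ℂ)
    ((convex_PP d N).linear_image Phi) (isClosed_cone d N) hM
  simp only [RCLike.re_to_complex] at hu hf
  have hu0 : u < 0 := by
    have := hf 0 ⟨0, fun j => PosSemidef.zero, map_zero _⟩
    simpa using this
  have hnn : ∀ A ∈ PP d N, 0 ≤ (f (Phi A)).re := by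
    intro A hA
    by_contra hneg
    push Not at hneg
    have := hf (Phi ((u / (f (Phi A)).re) • A))
      ⟨_, smul_PP hA (div_nonneg_of_nonpos hu0.le hneg.le), rfl⟩
    rw [map_smul, ContinuousLinearMap.map_smul_of_tower, Complex.real_smul, Complex.re_ofReal_mul,
      div_mul_cancel₀ _ hneg.ne] at this
    exact lt_irrefl _ this
  set K : Matrix (MIdx d N) (MIdx d N) ℂ := Matrix.of fun i j => f (Matrix.single i j 1) with hK
  have hfk : ∀ v, (f (vecMulVec (star v) v)).re = kf K v := by
    intro v
    rw [kf, hK]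
    exact congrArg Complex.re (functional f.toLinearMap v)
  have hc : ∀ j v, kf K (SS d N j *ᵥ v) ≤ kf K v := by
    intro j v
    have h1 := hnn (Pi.single j (vecMulVec (star v) v)) ?_
    · have h2 : Phi (Pi.single j (vecMulVec (star v) v)) =
          vecMulVec (star v) v - vecMulVec (star (SS d N j *ᵥ v)) (SS d N j *ᵥ v) := by
        rw [Phi_apply, Finset.sum_eq_single j]
        · rw [Pi.single_eq_same]
          congr 1
          exact SS_vecMulVec j v
        · intro i _ hi
          simp [hi]
        · simp
      rw [h2, map_sub, Complex.sub_re, hfk, hfk] at h1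
      linarith
    · intro i
      by_cases hi : i = j
      · subst hi
        rw [Pi.single_eq_same]
        exact posSemidef_vecMulVec_star_self v
      · rw [Pi.single_eq_of_ne hi]
        exact PosSemidef.zero
  have := core3 hd p hdeg hvN K hc
  rw [map_sub, Complex.sub_re, hfk, hfk] at hu
  linarith

end SNil
/-- If `p` has total degree at most `N` and `‖p(T)‖ ≤ 1` for every simple
`N`-nilpotent `d`-tuple `T` of contractive matrices, then there are positive semi-definite
matrices `A^1,…,A^d` indexed by `[N]` with
`δ_{0,α,β} − conj(p_α) p_β = ∑_j (A^j_{α,β} − A^j_{α−e_j,β−e_j})` for all `α, β ∈ [N]`. -/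
theorem stmt1 (d N : ℕ) (hd : 1 ≤ d) (p : MvPolynomial (Fin d) ℂ)
    (hdeg : p.totalDegree ≤ N)
    (hvN : ∀ (n : ℕ) (T : Fin d → Matrix (Fin n) (Fin n) ℂ),
        IsSimpleNilTuple d N n T → (∀ j, matOpNorm (T j) ≤ 1) →
        matOpNorm (polyEval p T) ≤ 1) :
    ∃ A : Fin d → Matrix (MIdx d N) (MIdx d N) ℂ,
      (∀ j, (A j).PosSemidef) ∧
      ∀ α β : Fin d → ℕ, (∑ i, α i) ≤ N → (∑ i, β i) ≤ N →
        (if α = 0 ∧ β = 0 then (1 : ℂ) else 0)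
          - conj (p.coeff (Finsupp.equivFunOnFinite.symm α)) *
              p.coeff (Finsupp.equivFunOnFinite.symm β)
        = coneEntry A α β := by
  obtain ⟨A, hA, hPhi⟩ := SNil.exists_cone hd p hdeg hvN
  refine ⟨A, hA, ?_⟩
  intro α β hα hβ
  rw [SNil.coneEntry_eq A α β hα hβ, hPhi, Matrix.sub_apply, Matrix.vecMulVec_apply,
    Matrix.vecMulVec_apply]
  congr 1
  simp only [SNil.EE, Pi.star_apply, SNil.vl_toIdx]
  by_cases h1 : α = 0 <;> by_cases h2 : β = 0 <;> simp [h1, h2]
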